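/- arXiv:2006.16085 — 5 statements merged into one kernel-verified Lean document; each statement's English description precedes it below -/
import Mathlib

section
/- Let μ be a probability measure on a measurable space 𝕏, ν a probability measure on a measurable space 𝕐, and T : 𝕏 → 𝕐 measurable with T_#μ = ν. Assume in addition that T maps measurable sets of 𝕏 to measurable sets of 𝕐 and that T is μ-essentially injective, i.e. there exists a measurable set B ⊆ 𝕏 with μ(B) = 1 on which T is injective. Then for every nonnegative ψ ∈ L¹(𝕏, μ), (P_Tψ) ∘ T = ψ μ-almost everywhere. -/
open MeasureTheory

/-- If `T` is injective on a conull set `B`, then every `A` agrees almost everywhere with the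
saturation `T ⁻¹' (T '' (A ∩ B))`. -/
theorem Set.InjOn.preimage_image_inter_ae_eq {X Y : Type*} [MeasurableSpace X] {μ : Measure X}
    {T : X → Y} {B : Set X} (hinj : Set.InjOn T B) (hB : ∀ᵐ x ∂μ, x ∈ B) (A : Set X) :
    T ⁻¹' (T '' (A ∩ B)) =ᵐ[μ] A := by
  filter_upwards [hB] with x hx
  apply propext
  constructor
  · rintro ⟨y, ⟨hyA, hyB⟩, hyx⟩
    exact hinj hyB hx hyx ▸ hyA
  · exact fun hxA => ⟨x, ⟨hxA, hx⟩, rfl⟩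

/-- For an essentially injective map preserving measurability of sets under images, the density of
the push-forward, composed with the map, is the original density. -/
theorem MeasureTheory.Measure.rnDeriv_map_withDensity_comp_ae_eq {X Y : Type*}
    [MeasurableSpace X] [MeasurableSpace Y] {μ : Measure X} [IsFiniteMeasure μ] {T : X → Y}
    (hT : Measurable T) (himg : ∀ A : Set X, MeasurableSet A → MeasurableSet (T '' A))
    {B : Set X} (hB : MeasurableSet B) (hBae : ∀ᵐ x ∂μ, x ∈ B) (hinj : Set.InjOn T B)
    {f : X → ENNReal} (hf : AEMeasurable f μ) (hfi : ∫⁻ x, f x ∂μ ≠ ⊤) :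
    (fun x => ((μ.withDensity f).map T).rnDeriv (μ.map T) (T x)) =ᵐ[μ] f := by
  have : IsFiniteMeasure (μ.withDensity f) := isFiniteMeasure_withDensity hfi
  have hac : (μ.withDensity f).map T ≪ μ.map T := (withDensity_absolutelyContinuous μ f).map hT
  have hg := Measure.measurable_rnDeriv ((μ.withDensity f).map T) (μ.map T)
  refine ae_eq_of_forall_setLIntegral_eq_of_sigmaFinite₀ (hg.comp hT).aemeasurable hf
    fun A hA _ => ?_
  have hsat := hinj.preimage_image_inter_ae_eq hBae A
  have hS := himg _ (hA.inter hB)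
  calc ∫⁻ x in A, ((μ.withDensity f).map T).rnDeriv (μ.map T) (T x) ∂μ
      = ∫⁻ x in T ⁻¹' (T '' (A ∩ B)), ((μ.withDensity f).map T).rnDeriv (μ.map T) (T x) ∂μ :=
        (setLIntegral_congr hsat).symm
    _ = ∫⁻ y in T '' (A ∩ B), ((μ.withDensity f).map T).rnDeriv (μ.map T) y ∂(μ.map T) :=
        (setLIntegral_map hS hg hT).symm
    _ = (μ.withDensity f).map T (T '' (A ∩ B)) := Measure.setLIntegral_rnDeriv hac _
    _ = ∫⁻ x in T ⁻¹' (T '' (A ∩ B)), f x ∂μ := by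
        rw [Measure.map_apply hT hS, withDensity_apply _ (hT hS)]
    _ = ∫⁻ x in A, f x ∂μ := setLIntegral_congr hsat

theorem stmt_2 {X Y : Type*} [MeasurableSpace X] [MeasurableSpace Y]
    (μ : Measure X) (ν : Measure Y) [IsProbabilityMeasure μ] [IsProbabilityMeasure ν]
    (T : X → Y) (hT : Measurable T) (hTpush : μ.map T = ν)
    (himg : ∀ A : Set X, MeasurableSet A → MeasurableSet (T '' A))
    (B : Set X) (hB : MeasurableSet B) (hμB : μ B = 1) (hinj : Set.InjOn T B)
    (ψ : X → ℝ) (hψ : Integrable ψ μ) (hψ0 : 0 ≤ ψ) :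
    (fun x => (((μ.withDensity fun x => ENNReal.ofReal (ψ x)).map T).rnDeriv ν (T x)).toReal)
      =ᵐ[μ] ψ := by
  subst hTpush
  have hBae : ∀ᵐ x ∂μ, x ∈ B := (mem_ae_iff_prob_eq_one hB).2 hμB
  filter_upwards [Measure.rnDeriv_map_withDensity_comp_ae_eq hT himg hB hBae hinj
    hψ.aemeasurable.ennreal_ofReal hψ.lintegral_lt_top.ne] with x hx
  rw [hx, ENNReal.toReal_ofReal (hψ0 x)]
end

section
/- Let 𝕏, 𝕐 ⊂ ℝ^d be compact sets with boundaries of Lebesgue measure zero, satisfying λ(B_ε(x)) > 0 and λ(B_ε(y)) > 0 for every ε > 0, x ∈ 𝕏, y ∈ 𝕐, and the uniform ball-ratio bound sup_{ε>0} (max_{x∈𝕏} λ(B_ε(x)) / min_{x∈𝕏} λ(B_ε(x))) < C_𝕏 < ∞ (and analogously for 𝕐). Let μ = σ_μ λ and ν = σ_ν λ be Borel probability measures on 𝕏 and 𝕐 respectively whose densities are positive almost everywhere, with σ_μ ∈ L_∞(𝕏) continuous λ-almost everywhere. Let T : 𝕏 → 𝕐 be a measurable map with T_#μ = ν, and set π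 := (id, T)_#μ ∈ P(𝕏 × 𝕐). For ε > 0 define σ_ε(y) := ∫_𝕏 k_ε(x, y) dμ(x) and ν_ε := σ_ε λ. Then, as ε → 0, the measures k_ε(x, y) dμ(x) dy on 𝕏 × 𝕐 converge weakly to π, and ν_ε converges weakly to ν. -/
open MeasureTheory Metric Set Filter

theorem abs_setAverage_sub_le {E : Type*} [MeasurableSpace E] {m : Measure E} {s : Set E}
    (hm : m s ≠ 0) (hm' : m s ≠ ⊤) {h g : E → ℝ} {δ : ℝ} (hh : IntegrableOn h s m)
    (hg : IntegrableOn g s m) (hδ : ∀ z ∈ s, |h z - g z| ≤ δ) :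
    |⨍ z in s, h z ∂m - ⨍ z in s, g z ∂m| ≤ δ := by
  have hpos : 0 < m.real s := ENNReal.toReal_pos hm hm'
  rw [setAverage_eq, setAverage_eq, ← smul_sub, ← integral_sub hh hg, smul_eq_mul, abs_mul,
    abs_of_pos (inv_pos.2 hpos), inv_mul_le_iff₀ hpos, mul_comm]
  exact norm_setIntegral_le_of_norm_le_const (f := fun z => h z - g z) hm'.lt_top hδ

section BallDensity

variable {E : Type*} [PseudoMetricSpace E] [MeasurableSpace E]

/-- The uniform density on the open `ε`-ball around `x` intersected with `S`. -/
noncomputable def ballDensity (m : Measure E) (S : Set E) (ε : ℝ) (x z : E) : ℝ :=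
  (ball x ε ∩ S).indicator (fun _ => (1 : ℝ)) z / (m (ball x ε ∩ S)).toReal

theorem ballDensity_nonneg (m : Measure E) (S : Set E) (ε : ℝ) (x z : E) :
    0 ≤ ballDensity m S ε x z :=
  div_nonneg (indicator_nonneg (fun _ _ => zero_le_one) _) ENNReal.toReal_nonneg

theorem measurable_ballDensity [SecondCountableTopology E] [OpensMeasurableSpace E]
    (m : Measure E) [SFinite m] {S : Set E} (hS : MeasurableSet S) (ε : ℝ) :
    Measurable fun p : E × E => ballDensity m S ε p.1 p.2 := by
  have hset : MeasurableSet {p : E × E | p.2 ∈ ball p.1 ε ∩ S} :=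
    (measurableSet_lt (measurable_snd.dist measurable_fst) measurable_const).inter
      (measurable_snd hS)
  have hvol : Measurable fun x => m (ball x ε ∩ S) := measurable_measure_prodMk_left hset
  have hind : Measurable fun p : E × E => (ball p.1 ε ∩ S).indicator (fun _ => (1 : ℝ)) p.2 :=
    (measurable_const (a := (1 : ℝ))).indicator hset
  exact hind.div (hvol.comp measurable_fst).ennreal_toReal

theorem exists_ballDensity_le {m : Measure E} {S : Set E} {ε C : ℝ}
    (hC : ∀ x ∈ S, ∀ x' ∈ S, (m (ball x ε ∩ S)).toReal < C * (m (ball x' ε ∩ S)).toReal) :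
    ∃ A, 0 ≤ A ∧ ∀ x ∈ S, ∀ z, ballDensity m S ε x z ≤ A := by
  rcases S.eq_empty_or_nonempty with rfl | ⟨x₀, hx₀⟩
  · exact ⟨0, le_rfl, by simp⟩
  refine ⟨|C| / (m (ball x₀ ε ∩ S)).toReal, by positivity, fun x hx z => ?_⟩
  have pos : ∀ x ∈ S, 0 < (m (ball x ε ∩ S)).toReal := fun x hx =>
    ENNReal.toReal_nonneg.lt_of_ne fun h => by simpa [← h] using hC x hx x hx
  have hle : (ball x ε ∩ S).indicator (fun _ => (1 : ℝ)) z ≤ 1 :=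
    indicator_le_self' (fun _ _ => zero_le_one) z
  rw [ballDensity, div_le_div_iff₀ (pos x hx) (pos x₀ hx₀)]
  calc _ ≤ 1 * (m (ball x₀ ε ∩ S)).toReal := by gcongr
    _ ≤ C * (m (ball x ε ∩ S)).toReal := by rw [one_mul]; exact (hC x₀ hx₀ x hx).le
    _ ≤ _ := by gcongr; exact le_abs_self C

theorem setIntegral_ballDensity_mul [OpensMeasurableSpace E] (m : Measure E) {S : Set E}
    (hS : MeasurableSet S) (ε : ℝ) (x : E) (h : E → ℝ) :
    ∫ z in S, ballDensity m S ε x z * h z ∂m = ⨍ z in ball x ε ∩ S, h z ∂m := by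
  have hball : MeasurableSet (ball x ε ∩ S) := measurableSet_ball.inter hS
  have heq : (fun z => ballDensity m S ε x z * h z) = (ball x ε ∩ S).indicator
      fun z => (m (ball x ε ∩ S)).toReal⁻¹ * h z := by
    ext z
    by_cases hz : z ∈ ball x ε ∩ S <;> simp [ballDensity, hz]
  rw [heq, setIntegral_indicator hball, inter_eq_right.2 inter_subset_right,
    integral_const_mul, setAverage_eq, smul_eq_mul, measureReal_def]

/-- The kernel `k_ε` obtained by smoothing the graph of `T` in both variables. -/
noncomputable def smoothedKernel (m : Measure E) (X Y : Set E) (T : E → E) (ε : ℝ) (x y : E) : ℝ :=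
  ∫ z in X, ballDensity m X ε x z * ballDensity m Y ε (T z) y ∂m

theorem smoothedKernel_nonneg (m : Measure E) (X Y : Set E) (T : E → E) (ε : ℝ) (x y : E) :
    0 ≤ smoothedKernel m X Y T ε x y :=
  integral_nonneg fun _ => mul_nonneg (ballDensity_nonneg ..) (ballDensity_nonneg ..)

theorem measurable_smoothedKernel [SecondCountableTopology E]
    [OpensMeasurableSpace E] (m : Measure E) [SFinite m] {X Y : Set E}
    (hX : MeasurableSet X) (hY : MeasurableSet Y) {T : E → E} (hT : Measurable T) (ε : ℝ) :
    Measurable fun p : E × E => smoothedKernel m X Y T ε p.1 p.2 := by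
  have h : Measurable fun q : (E × E) × E =>
      ballDensity m X ε q.1.1 q.2 * ballDensity m Y ε (T q.2) q.1.2 :=
    ((measurable_ballDensity m hX ε).comp
      (measurable_fst.fst.prodMk measurable_snd)).mul
    ((measurable_ballDensity m hY ε).comp
      ((hT.comp measurable_snd).prodMk measurable_fst.snd))
  exact (h.stronglyMeasurable.integral_prod_right (ν := m.restrict X)).measurable

theorem exists_smoothedKernel_le {m : Measure E} [IsFiniteMeasureOnCompacts m] {X Y : Set E}
    {T : E → E} {ε CX CY : ℝ} (hX : IsCompact X) (hTXY : MapsTo T X Y)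
    (hCX : ∀ x ∈ X, ∀ x' ∈ X,
      (m (ball x ε ∩ X)).toReal < CX * (m (ball x' ε ∩ X)).toReal)
    (hCY : ∀ y ∈ Y, ∀ y' ∈ Y,
      (m (ball y ε ∩ Y)).toReal < CY * (m (ball y' ε ∩ Y)).toReal) :
    ∃ A, ∀ x ∈ X, ∀ y, smoothedKernel m X Y T ε x y ≤ A := by
  obtain ⟨A, hA, hA'⟩ := exists_ballDensity_le hCX
  obtain ⟨B, hB, hB'⟩ := exists_ballDensity_le hCY
  refine ⟨A * B * m.real X, fun x hx y => (le_abs_self _).trans ?_⟩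
  refine norm_setIntegral_le_of_norm_le_const (E := ℝ) hX.measure_lt_top fun z hz => ?_
  rw [Real.norm_of_nonneg (mul_nonneg (ballDensity_nonneg ..) (ballDensity_nonneg ..))]
  exact mul_le_mul (hA' x hx z) (hB' _ (hTXY hz) y) (ballDensity_nonneg ..) hA

end BallDensity

theorem ae_tendsto_average_ball_inter {E : Type*} [NormedAddCommGroup E] [NormedSpace ℝ E]
    [FiniteDimensional ℝ E] [MeasurableSpace E] [BorelSpace E] (m : Measure E)
    [m.IsAddHaarMeasure] {S : Set E} (hS : IsClosed S) (hSf : m (frontier S) = 0)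
    {h : E → ℝ} (hh : LocallyIntegrable h m) :
    ∀ᵐ x ∂m.restrict S,
      Tendsto (fun ε => ⨍ z in ball x ε ∩ S, h z ∂m) (nhdsWithin 0 (Ioi 0)) (nhds (h x)) := by
  have hfr : ∀ᵐ x ∂m, x ∉ frontier S := measure_eq_zero_iff_ae_notMem.1 hSf
  rw [ae_restrict_iff' hS.measurableSet]
  filter_upwards [IsUnifLocDoublingMeasure.ae_tendsto_average m hh 1, hfr] with x hx hxf hxS
  have hint : x ∈ interior S := by
    by_contra hc
    exact hxf ⟨subset_closure hxS, hc⟩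
  obtain ⟨r, hr, hball⟩ := Metric.isOpen_iff.1 isOpen_interior x hint
  have hlim := hx (fun _ : ℝ => x) id tendsto_id (by
    filter_upwards [self_mem_nhdsWithin] with ε hε
    simpa using (mem_Ioi.1 hε).le)
  refine hlim.congr' ?_
  filter_upwards [Ioo_mem_nhdsGT hr] with ε hε
  have hsub : ball x ε ⊆ S := (ball_subset_ball hε.2.le).trans (hball.trans interior_subset)
  have hae : (closedBall x ε : Set E) =ᵐ[m] ball x ε := by
    rw [← ball_union_sphere]
    exact union_ae_eq_left_of_ae_eq_empty
      (ae_eq_empty.2 (Measure.addHaar_sphere_of_ne_zero m x hε.1.ne'))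
  rw [inter_eq_left.2 hsub, id, setAverage_congr hae]

section Smoothing

variable {E : Type*} [NormedAddCommGroup E] [NormedSpace ℝ E] [FiniteDimensional ℝ E]
  [MeasurableSpace E] [BorelSpace E]

variable {m : Measure E} {X Y : Set E} {T : E → E} {ε CX CY : ℝ}

theorem integrable_smoothedKernel_mul [IsFiniteMeasureOnCompacts m] (hX : IsCompact X) (hY : IsCompact Y)
    (hT : Measurable T) (hTXY : MapsTo T X Y)
    (hCX : ∀ x ∈ X, ∀ x' ∈ X,
      (m (ball x ε ∩ X)).toReal < CX * (m (ball x' ε ∩ X)).toReal)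
    (hCY : ∀ y ∈ Y, ∀ y' ∈ Y,
      (m (ball y ε ∩ Y)).toReal < CY * (m (ball y' ε ∩ Y)).toReal)
    {μ : Measure E} [IsFiniteMeasure μ] (hμX : ∀ᵐ x ∂μ, x ∈ X)
    {f : E × E → ℝ} (hf : Continuous f) {C : ℝ} (hfC : ∀ p, |f p| ≤ C) :
    Integrable (fun p : E × E => smoothedKernel m X Y T ε p.1 p.2 * f p)
      (μ.prod (m.restrict Y)) := by
  have : IsFiniteMeasure (m.restrict Y) := isFiniteMeasure_restrict.2 hY.measure_ne_top
  obtain ⟨A, hA⟩ := exists_smoothedKernel_le hX hTXY hCX hCY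
  refine Integrable.mul_bdd (c := C) ?_ hf.aestronglyMeasurable (ae_of_all _ hfC)
  refine Integrable.of_bound (measurable_smoothedKernel m hX.measurableSet hY.measurableSet hT
    ε).aestronglyMeasurable A ?_
  filter_upwards [Measure.quasiMeasurePreserving_fst.ae hμX] with p hp
  rw [Real.norm_of_nonneg (smoothedKernel_nonneg ..)]
  exact hA _ hp _

theorem setIntegral_smoothedKernel_mul [IsFiniteMeasureOnCompacts m] (hX : IsCompact X) (hY : IsCompact Y)
    (hT : Measurable T) (hTXY : MapsTo T X Y)
    (hCX : ∀ x ∈ X, ∀ x' ∈ X,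
      (m (ball x ε ∩ X)).toReal < CX * (m (ball x' ε ∩ X)).toReal)
    (hCY : ∀ y ∈ Y, ∀ y' ∈ Y,
      (m (ball y ε ∩ Y)).toReal < CY * (m (ball y' ε ∩ Y)).toReal)
    {g : E → ℝ} (hg : Continuous g) {C : ℝ} (hgC : ∀ p, |g p| ≤ C) {x : E} (hx : x ∈ X) :
    ∫ y in Y, smoothedKernel m X Y T ε x y * g y ∂m =
      ⨍ z in ball x ε ∩ X, ⨍ y in ball (T z) ε ∩ Y, g y ∂m ∂m := by
  have : IsFiniteMeasure (m.restrict Y) := isFiniteMeasure_restrict.2 hY.measure_ne_top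
  have : IsFiniteMeasure (m.restrict X) := isFiniteMeasure_restrict.2 hX.measure_ne_top
  obtain ⟨A, hA, hA'⟩ := exists_ballDensity_le hCX
  obtain ⟨B, hB, hB'⟩ := exists_ballDensity_le hCY
  have hmeas : Measurable fun q : E × E =>
      ballDensity m X ε x q.2 * ballDensity m Y ε (T q.2) q.1 :=
    ((measurable_ballDensity m hX.measurableSet ε).comp
      (measurable_const.prodMk measurable_snd)).mul
    ((measurable_ballDensity m hY.measurableSet ε).comp
      ((hT.comp measurable_snd).prodMk measurable_fst))
  have hint : Integrable (fun q : E × E =>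
      ballDensity m X ε x q.2 * ballDensity m Y ε (T q.2) q.1 * g q.1)
      ((m.restrict Y).prod (m.restrict X)) := by
    refine Integrable.mul_bdd (c := C) ?_ (hg.comp continuous_fst).aestronglyMeasurable
      (ae_of_all _ fun q => hgC q.1)
    refine Integrable.of_bound hmeas.aestronglyMeasurable (A * B) ?_
    filter_upwards [Measure.quasiMeasurePreserving_snd.ae
      (ae_restrict_mem hX.measurableSet)] with q hq
    rw [Real.norm_of_nonneg (mul_nonneg (ballDensity_nonneg ..) (ballDensity_nonneg ..))]
    exact mul_le_mul (hA' x hx _) (hB' _ (hTXY hq) _) (ballDensity_nonneg ..) hA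
  simp_rw [smoothedKernel, ← integral_mul_const]
  rw [integral_integral_swap hint]
  simp_rw [mul_assoc, integral_const_mul, setIntegral_ballDensity_mul m hY.measurableSet]
  exact setIntegral_ballDensity_mul m hX.measurableSet ε x _

theorem abs_average_average_sub_le [IsFiniteMeasureOnCompacts m] (hX : IsCompact X) (hY : IsCompact Y)
    (hXball : ∀ x ∈ X, m (ball x ε ∩ X) ≠ 0) (hYball : ∀ y ∈ Y, m (ball y ε ∩ Y) ≠ 0)
    (hT : Measurable T) (hTXY : MapsTo T X Y)
    {g h : E → ℝ} (hg : Continuous g) {C : ℝ} (hgC : ∀ p, |g p| ≤ C)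
    (hh : LocallyIntegrable h m) {δ : ℝ} {x : E} (hx : x ∈ X)
    (hδ : ∀ z ∈ ball x ε ∩ X, ∀ y ∈ ball (T z) ε ∩ Y, |g y - h z| ≤ δ) :
    |⨍ z in ball x ε ∩ X, ⨍ y in ball (T z) ε ∩ Y, g y ∂m ∂m -
      ⨍ z in ball x ε ∩ X, h z ∂m| ≤ δ := by
  have hYfin : ∀ y, m (ball y ε ∩ Y) ≠ ⊤ := fun y =>
    measure_ne_top_of_subset inter_subset_right hY.measure_ne_top
  have hXfin : m (ball x ε ∩ X) ≠ ⊤ :=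
    measure_ne_top_of_subset inter_subset_right hX.measure_ne_top
  have hsX : MeasurableSet (ball x ε ∩ X) := measurableSet_ball.inter hX.measurableSet
  have inner : ∀ z ∈ X, ∀ c δ', (∀ y ∈ ball (T z) ε ∩ Y, |g y - c| ≤ δ') →
      |⨍ y in ball (T z) ε ∩ Y, g y ∂m - c| ≤ δ' := by
    intro z hz c δ' hc
    have := abs_setAverage_sub_le (hYball _ (hTXY hz)) (hYfin _) (g := fun _ => c)
      ((hg.locallyIntegrable.integrableOn_isCompact hY).mono_set inter_subset_right)
      (integrableOn_const (hYfin _)) hc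
    rwa [setAverage_const (hYball _ (hTXY hz)) (hYfin _)] at this
  refine abs_setAverage_sub_le (hXball x hx) hXfin ?_
    ((hh.integrableOn_isCompact hX).mono_set inter_subset_right)
    fun z hz => inner z hz.2 _ _ (hδ z hz)
  have : IsFiniteMeasure (m.restrict (ball x ε ∩ X)) := isFiniteMeasure_restrict.2 hXfin
  refine Integrable.of_bound ?_ C ((ae_restrict_iff' hsX).2 (ae_of_all _ fun z hz => ?_))
  · simp_rw [← setIntegral_ballDensity_mul m hY.measurableSet]
    have : Measurable fun q : E × E => ballDensity m Y ε (T q.1) q.2 * g q.2 :=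
      ((measurable_ballDensity m hY.measurableSet ε).comp
        ((hT.comp measurable_fst).prodMk measurable_snd)).mul (hg.measurable.comp measurable_snd)
    exact (this.stronglyMeasurable.integral_prod_right (ν := m.restrict Y)).aestronglyMeasurable
  · simpa using inner z hz.2 0 C fun y _ => by simpa using hgC y

theorem tendsto_average_average [m.IsAddHaarMeasure] (hX : IsCompact X) (hY : IsCompact Y)
    (hXf : m (frontier X) = 0)
    (hXball : ∀ ε > (0 : ℝ), ∀ x ∈ X, m (ball x ε ∩ X) ≠ 0)
    (hYball : ∀ ε > (0 : ℝ), ∀ y ∈ Y, m (ball y ε ∩ Y) ≠ 0)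
    (hT : Measurable T) (hTXY : MapsTo T X Y)
    {f : E × E → ℝ} (hf : Continuous f) {C : ℝ} (hfC : ∀ p, |f p| ≤ C) :
    ∀ᵐ x ∂m.restrict X,
      Tendsto (fun ε => ⨍ z in ball x ε ∩ X, ⨍ y in ball (T z) ε ∩ Y, f (x, y) ∂m ∂m)
        (nhdsWithin 0 (Ioi 0)) (nhds (f (x, T x))) := by
  have hh : LocallyIntegrable (fun z => f (z, T z)) m :=
    (locallyIntegrable_const C).mono
      (hf.measurable.comp (measurable_id.prodMk hT)).aestronglyMeasurable
      (ae_of_all _ fun z => (hfC _).trans (le_abs_self C))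
  filter_upwards [ae_tendsto_average_ball_inter m hX.isClosed hXf hh,
    ae_restrict_mem hX.measurableSet] with x hx hxX
  refine hx.congr_dist ?_
  rw [Metric.tendsto_nhds]
  intro δ hδ
  obtain ⟨r, hr, hrf⟩ := Metric.uniformContinuousOn_iff.1
    ((hX.prod hY).uniformContinuousOn_of_continuous hf.continuousOn) (δ / 2) (half_pos hδ)
  filter_upwards [Ioo_mem_nhdsGT hr] with ε hε
  rw [Real.dist_eq, sub_zero, abs_of_nonneg dist_nonneg, dist_comm, Real.dist_eq]
  refine (abs_average_average_sub_le hX hY (hXball ε hε.1) (hYball ε hε.1) hT hTXY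
    (hf.comp (Continuous.prodMk_right x)) (fun y => hfC (x, y)) hh hxX
    fun z hz y hy => ?_).trans_lt (half_lt_self hδ)
  refine (hrf (x, y) ⟨hxX, hy.2⟩ (z, T z) ⟨hz.2, hTXY hz.2⟩ ?_).le
  rw [Prod.dist_eq, dist_comm x z]
  exact max_lt (hz.1.trans hε.2) (lt_trans hy.1 hε.2)

theorem tendsto_integral_smoothedKernel [m.IsAddHaarMeasure] (hX : IsCompact X)
    (hY : IsCompact Y) (hXf : m (frontier X) = 0)
    (hXball : ∀ ε > (0 : ℝ), ∀ x ∈ X, m (ball x ε ∩ X) ≠ 0)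
    (hYball : ∀ ε > (0 : ℝ), ∀ y ∈ Y, m (ball y ε ∩ Y) ≠ 0)
    (hCX : ∀ ε > (0 : ℝ), ∀ x ∈ X, ∀ x' ∈ X,
      (m (ball x ε ∩ X)).toReal < CX * (m (ball x' ε ∩ X)).toReal)
    (hCY : ∀ ε > (0 : ℝ), ∀ y ∈ Y, ∀ y' ∈ Y,
      (m (ball y ε ∩ Y)).toReal < CY * (m (ball y' ε ∩ Y)).toReal)
    (hT : Measurable T) (hTXY : MapsTo T X Y)
    {μ : Measure E} [IsFiniteMeasure μ] (hμ : μ ≪ m.restrict X)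
    {f : E × E → ℝ} (hf : Continuous f) {C : ℝ} (hfC : ∀ p, |f p| ≤ C) :
    Tendsto (fun ε => ∫ x, ∫ y in Y, smoothedKernel m X Y T ε x y * f (x, y) ∂m ∂μ)
      (nhdsWithin 0 (Ioi 0)) (nhds (∫ x, f (x, T x) ∂μ)) := by
  have hμX : ∀ᵐ x ∂μ, x ∈ X := hμ.ae_le (ae_restrict_mem hX.measurableSet)
  have heq : ∀ ε > (0 : ℝ), ∀ x ∈ X, ∫ y in Y, smoothedKernel m X Y T ε x y * f (x, y) ∂m =
      ⨍ z in ball x ε ∩ X, ⨍ y in ball (T z) ε ∩ Y, f (x, y) ∂m ∂m := fun ε hε x hx =>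
    setIntegral_smoothedKernel_mul hX hY hT hTXY (hCX ε hε) (hCY ε hε)
      (hf.comp (Continuous.prodMk_right x)) (fun y => hfC (x, y)) hx
  refine tendsto_integral_filter_of_dominated_convergence (fun _ => C) ?_ ?_
    (integrable_const C) ?_
  · filter_upwards with ε
    exact ((measurable_smoothedKernel m hX.measurableSet hY.measurableSet hT ε).mul
      hf.measurable).stronglyMeasurable.integral_prod_right.aestronglyMeasurable
  · filter_upwards [self_mem_nhdsWithin] with ε hε
    filter_upwards [hμX] with x hx
    rw [heq ε hε x hx]
    simpa using abs_average_average_sub_le hX hY (hXball ε hε) (hYball ε hε) hT hTXY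
      (hf.comp (Continuous.prodMk_right x)) (fun y => hfC (x, y)) (h := fun _ => 0)
      (locallyIntegrable_const 0) hx fun z _ y _ => by simpa using hfC (x, y)
  · filter_upwards [hμX, hμ.ae_le (tendsto_average_average hX hY hXf hXball hYball hT hTXY
      hf hfC)] with x hx hlim
    refine hlim.congr' ?_
    filter_upwards [self_mem_nhdsWithin] with ε hε
    exact (heq ε hε x hx).symm

end Smoothing

theorem stmt_11 {d : ℕ}
    (X Y : Set (EuclideanSpace ℝ (Fin d)))
    (hX : IsCompact X) (hY : IsCompact Y)
    (hXf : volume (frontier X) = 0) (hYf : volume (frontier Y) = 0)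
    (hXball : ∀ ε > (0 : ℝ), ∀ x ∈ X, 0 < volume (ball x ε ∩ X))
    (hYball : ∀ ε > (0 : ℝ), ∀ y ∈ Y, 0 < volume (ball y ε ∩ Y))
    (CX CY : ℝ)
    (hCX : ∀ ε > (0 : ℝ), ∀ x ∈ X, ∀ x' ∈ X,
      (volume (ball x ε ∩ X)).toReal < CX * (volume (ball x' ε ∩ X)).toReal)
    (hCY : ∀ ε > (0 : ℝ), ∀ y ∈ Y, ∀ y' ∈ Y,
      (volume (ball y ε ∩ Y)).toReal < CY * (volume (ball y' ε ∩ Y)).toReal)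
    (σμ σν : EuclideanSpace ℝ (Fin d) → ℝ)
    (μ ν : Measure (EuclideanSpace ℝ (Fin d)))
    [IsProbabilityMeasure μ] [IsProbabilityMeasure ν]
    (hμ : μ = (volume.restrict X).withDensity fun x => ENNReal.ofReal (σμ x))
    (hν : ν = (volume.restrict Y).withDensity fun y => ENNReal.ofReal (σν y))
    (hσμpos : ∀ᵐ x ∂volume.restrict X, 0 < σμ x)
    (hσνpos : ∀ᵐ y ∂volume.restrict Y, 0 < σν y)
    (M : ℝ) (hσμbdd : ∀ x, σμ x ≤ M)
    (hσμcont : ∀ᵐ x ∂volume.restrict X, ContinuousAt σμ x)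
    (T : EuclideanSpace ℝ (Fin d) → EuclideanSpace ℝ (Fin d))
    (hT : Measurable T) (hTXY : Set.MapsTo T X Y) (hTpush : μ.map T = ν)
    (π : Measure (EuclideanSpace ℝ (Fin d) × EuclideanSpace ℝ (Fin d)))
    (hπ : π = μ.map fun x => (x, T x))
    (k : ℝ → EuclideanSpace ℝ (Fin d) → EuclideanSpace ℝ (Fin d) → ℝ)
    (hk : ∀ ε x y, k ε x y =
      ∫ z in X,
        ((ball x ε ∩ X).indicator (fun _ => (1 : ℝ)) z / (volume (ball x ε ∩ X)).toReal) *
        ((ball (T z) ε ∩ Y).indicator (fun _ => (1 : ℝ)) y /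
          (volume (ball (T z) ε ∩ Y)).toReal))
    (mKer : ℝ → Measure (EuclideanSpace ℝ (Fin d) × EuclideanSpace ℝ (Fin d)))
    (hm : ∀ ε, mKer ε =
      (μ.prod (volume.restrict Y)).withDensity fun p => ENNReal.ofReal (k ε p.1 p.2))
    (νε : ℝ → Measure (EuclideanSpace ℝ (Fin d)))
    (hνε : ∀ ε, νε ε =
      (volume.restrict Y).withDensity fun y => ENNReal.ofReal (∫ x, k ε x y ∂μ)) :
    (∀ f : EuclideanSpace ℝ (Fin d) × EuclideanSpace ℝ (Fin d) → ℝ,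
      Continuous f → (∃ C, ∀ p, |f p| ≤ C) →
      Tendsto (fun ε => ∫ p, f p ∂mKer ε) (nhdsWithin 0 (Set.Ioi 0))
        (nhds (∫ p, f p ∂π))) ∧
    (∀ g : EuclideanSpace ℝ (Fin d) → ℝ,
      Continuous g → (∃ C, ∀ y, |g y| ≤ C) →
      Tendsto (fun ε => ∫ y, g y ∂νε ε) (nhdsWithin 0 (Set.Ioi 0))
        (nhds (∫ y, g y ∂ν))) := by
  have hkε : k = smoothedKernel volume X Y T := by
    ext ε x y
    exact hk ε x y
  have hμac : μ ≪ volume.restrict X := hμ ▸ withDensity_absolutelyContinuous _ _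
  have hμX : ∀ᵐ x ∂μ, x ∈ X := hμac.ae_le (ae_restrict_mem hX.measurableSet)
  have hlim := fun (f : EuclideanSpace ℝ (Fin d) × EuclideanSpace ℝ (Fin d) → ℝ)
    (hf : Continuous f) (C : ℝ) (hfC : ∀ p, |f p| ≤ C) =>
    tendsto_integral_smoothedKernel hX hY hXf (fun ε hε x hx => (hXball ε hε x hx).ne')
      (fun ε hε y hy => (hYball ε hε y hy).ne') hCX hCY hT hTXY hμac hf hfC
  have hint := fun (f : EuclideanSpace ℝ (Fin d) × EuclideanSpace ℝ (Fin d) → ℝ)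
    (hf : Continuous f) (C : ℝ) (hfC : ∀ p, |f p| ≤ C) (ε : ℝ) (hε : 0 < ε) =>
    integrable_smoothedKernel_mul hX hY hT hTXY (hCX ε hε) (hCY ε hε) hμX hf hfC
  have hmeas : ∀ ε, Measurable fun p : EuclideanSpace ℝ (Fin d) × EuclideanSpace ℝ (Fin d) =>
      smoothedKernel volume X Y T ε p.1 p.2 :=
    measurable_smoothedKernel volume hX.measurableSet hY.measurableSet hT
  subst hkε
  refine ⟨fun f hf ⟨C, hfC⟩ => ?_, fun g hg ⟨C, hgC⟩ => ?_⟩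
  · rw [hπ, integral_map (measurable_id'.prodMk hT).aemeasurable hf.aestronglyMeasurable]
    refine (hlim f hf C hfC).congr' ?_
    filter_upwards [self_mem_nhdsWithin] with ε hε
    rw [hm, integral_withDensity_eq_integral_toReal_smul (hmeas ε).ennreal_ofReal
      (ae_of_all _ fun _ => ENNReal.ofReal_lt_top)]
    simp_rw [ENNReal.toReal_ofReal (smoothedKernel_nonneg ..), smul_eq_mul]
    exact (integral_prod _ (hint f hf C hfC ε hε)).symm
  · rw [← hTpush, integral_map hT.aemeasurable hg.aestronglyMeasurable]
    refine (hlim (fun p => g p.2) (hg.comp continuous_snd) C fun p => hgC p.2).congr' ?_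
    filter_upwards [self_mem_nhdsWithin] with ε hε
    have hmeas' : Measurable fun y => ∫ x, smoothedKernel volume X Y T ε x y ∂μ :=
      (hmeas ε).stronglyMeasurable.integral_prod_left'.measurable
    rw [hνε, integral_withDensity_eq_integral_toReal_smul hmeas'.ennreal_ofReal
      (ae_of_all _ fun _ => ENNReal.ofReal_lt_top)]
    simp_rw [ENNReal.toReal_ofReal (integral_nonneg fun _ => smoothedKernel_nonneg ..),
      smul_eq_mul, ← integral_mul_const]
    exact integral_integral_swap
      (hint (fun p => g p.2) (hg.comp continuous_snd) C (fun p => hgC p.2) ε hε)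
end

section
/- Let 𝕏, 𝕐 ⊂ ℝ^d be compact, λ the Lebesgue measure, and T : 𝕏 → 𝕐 a measurable map that is non-singular with respect to λ, so that λ(T⁻¹(N)) = 0 whenever N ⊂ 𝕐 has Lebesgue measure zero. Let B ⊂ 𝕐 be a Borel set with λ(∂B) = 0, and assume λ(B_ε(y)) > 0 for every y ∈ 𝕐 and ε > 0. Then for λ-almost every z ∈ 𝕏, g_{ε,B}(z) := ∫_B η_{ε,T(z)}(y) dy converges to 1_{T⁻¹(B)}(z) as ε → 0. -/
open MeasureTheory Metric Set Filter

theorem stmt_13 {d : ℕ} (X Y : Set (EuclideanSpace ℝ (Fin d)))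
    (hX : IsCompact X) (hY : IsCompact Y)
    (T : EuclideanSpace ℝ (Fin d) → EuclideanSpace ℝ (Fin d))
    (hT : Measurable T) (hTXY : Set.MapsTo T X Y)
    (hns : ∀ N : Set (EuclideanSpace ℝ (Fin d)), MeasurableSet N → N ⊆ Y →
      volume N = 0 → volume (X ∩ T ⁻¹' N) = 0)
    (B : Set (EuclideanSpace ℝ (Fin d))) (hB : MeasurableSet B) (hBY : B ⊆ Y)
    (hBf : volume (frontier B) = 0)
    (hYball : ∀ ε > (0 : ℝ), ∀ y ∈ Y, 0 < volume (ball y ε ∩ Y)) :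
    ∀ᵐ z ∂volume.restrict X,
      Tendsto
        (fun ε => ∫ y in B,
          (ball (T z) ε ∩ Y).indicator (fun _ => (1 : ℝ)) y /
            (volume (ball (T z) ε ∩ Y)).toReal)
        (nhdsWithin 0 (Set.Ioi 0))
        (nhds ((T ⁻¹' B).indicator (fun _ => (1 : ℝ)) z)) := by
  have hN : volume (X ∩ T ⁻¹' (frontier B ∩ Y)) = 0 :=
    hns _ (isClosed_frontier.measurableSet.inter hY.measurableSet) inter_subset_right
      (measure_mono_null inter_subset_left hBf)
  have hae : ∀ᵐ z ∂volume.restrict X, z ∈ X ∧ T z ∉ frontier B := by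
    rw [ae_restrict_iff' hX.measurableSet]
    filter_upwards [measure_eq_zero_iff_ae_notMem.1 hN] with z hz hzX
    exact ⟨hzX, fun h => hz ⟨hzX, h, hTXY hzX⟩⟩
  filter_upwards [hae] with z hz
  obtain ⟨hzX, hzf⟩ := hz
  apply tendsto_const_nhds.congr'
  by_cases hzB : T z ∈ B
  · have hint : T z ∈ interior B := by
      by_contra h
      exact hzf ⟨subset_closure hzB, h⟩
    obtain ⟨δ, hδ, hball⟩ := Metric.isOpen_iff.1 isOpen_interior _ hint
    filter_upwards [Ioo_mem_nhdsGT hδ] with ε hε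
    have hsub : ball (T z) ε ∩ Y ⊆ B :=
      inter_subset_left.trans ((ball_subset_ball hε.2.le).trans (hball.trans interior_subset))
    have hpos := hYball ε hε.1 (T z) (hTXY hzX)
    have hfin : volume (ball (T z) ε ∩ Y) ≠ ⊤ :=
      ((measure_mono inter_subset_left).trans_lt measure_ball_lt_top).ne
    have hmeas : MeasurableSet (ball (T z) ε ∩ Y) := measurableSet_ball.inter hY.measurableSet
    rw [integral_div, integral_indicator_const _ hmeas, measureReal_restrict_apply hmeas,
      inter_eq_left.2 hsub, indicator_of_mem (mem_preimage.2 hzB), smul_eq_mul, mul_one]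
    exact (div_self (ENNReal.toReal_pos hpos.ne' hfin).ne').symm
  · have hcl : T z ∈ (closure B)ᶜ := fun h => hzf ⟨h, fun hi => hzB (interior_subset hi)⟩
    obtain ⟨δ, hδ, hball⟩ := Metric.isOpen_iff.1 isClosed_closure.isOpen_compl _ hcl
    filter_upwards [Ioo_mem_nhdsGT hδ] with ε hε
    rw [indicator_of_notMem (by exact hzB)]
    refine (setIntegral_eq_zero_of_forall_eq_zero fun y hy => ?_).symm
    rw [indicator_of_notMem, zero_div]
    exact fun h => hball (ball_subset_ball hε.2.le h.1) (subset_closure hy)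
end

section
/- Let 𝕏 ⊂ ℝ^d be compact with the Lebesgue measure λ restricted to it, and let μ, ν ∈ P(𝕏) be absolutely continuous with respect to λ with KL(μ ⊗ ν, λ ⊗ λ) < ∞. Then for every π ∈ Π(μ, ν) with π ≪ λ ⊗ λ (equivalently, π ≪ μ ⊗ ν), the identity KL(π, λ ⊗ λ) = KL(π, μ ⊗ ν) + KL(μ ⊗ ν, λ ⊗ λ) holds in [0, ∞]; equivalently, KL(π, λ ⊗ λ) − KL(μ ⊗ ν, λ ⊗ λ) = KL(π, μ ⊗ ν) whenever KL(π, λ ⊗ λ) < ∞. -/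
open MeasureTheory

/-- The Kullback--Leibler divergence
`KL(α, β) = ∫ log (dα/dβ) dα + β(univ) - α(univ)` (real-valued version, meaningful
when `α ≪ β` and the log-integral exists). -/
noncomputable def KLr {Z : Type*} [MeasurableSpace Z] (α β : Measure Z) : ℝ :=
  (∫ z, Real.log ((α.rnDeriv β z).toReal) ∂α) + (β Set.univ).toReal - (α Set.univ).toReal

namespace MeasureTheory

variable {Z Y : Type*} [MeasurableSpace Z] [MeasurableSpace Y]

/-- Chain rule for log-likelihood ratios along `α ≪ β ≪ γ`. -/
lemma llr_ae_eq_llr_add_llr {α β γ : Measure Z} [SigmaFinite α] [SigmaFinite β] [SigmaFinite γ]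
    (hαβ : α ≪ β) (hβγ : β ≪ γ) :
    llr α γ =ᵐ[α] fun z ↦ llr α β z + llr β γ z := by
  have hαγ := hαβ.trans hβγ
  filter_upwards [hαγ.ae_le (Measure.rnDeriv_mul_rnDeriv (κ := γ) hαβ), Measure.rnDeriv_pos hαβ,
    hαβ.ae_le (Measure.rnDeriv_lt_top α β), hαβ.ae_le (Measure.rnDeriv_pos hβγ),
    hαγ.ae_le (Measure.rnDeriv_lt_top β γ)] with z hz h1 h2 h3 h4
  simp only [llr, ← hz, Pi.mul_apply, ENNReal.toReal_mul]
  exact Real.log_mul (ENNReal.toReal_pos h1.ne' h2.ne).ne' (ENNReal.toReal_pos h3.ne' h4.ne).ne'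

lemma Measure.rnDeriv_prod_prod {μ Λ : Measure Z} {ν Λ' : Measure Y} [SigmaFinite μ]
    [SigmaFinite ν] [SigmaFinite Λ] [SigmaFinite Λ'] (hμ : μ ≪ Λ) (hν : ν ≪ Λ') :
    (μ.prod ν).rnDeriv (Λ.prod Λ') =ᵐ[Λ.prod Λ']
      fun p ↦ μ.rnDeriv Λ p.1 * ν.rnDeriv Λ' p.2 := by
  have h : μ.prod ν =
      (Λ.prod Λ').withDensity fun p ↦ μ.rnDeriv Λ p.1 * ν.rnDeriv Λ' p.2 := by
    have := prod_withDensity (μ := Λ) (ν := Λ') (Measure.measurable_rnDeriv μ Λ)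
      (Measure.measurable_rnDeriv ν Λ')
    rwa [Measure.withDensity_rnDeriv_eq _ _ hμ, Measure.withDensity_rnDeriv_eq _ _ hν] at this
  conv_lhs => rw [h]
  exact Measure.rnDeriv_withDensity _ (by fun_prop)

/-- A measure dominated by the product reference measure is dominated by the product of
its marginals. -/
lemma Measure.absolutelyContinuous_prod_map_fst_map_snd {π : Measure (Z × Y)} {Λ : Measure Z}
    {Λ' : Measure Y} [IsFiniteMeasure π] [SigmaFinite Λ] [SigmaFinite Λ']
    (hμ : π.map Prod.fst ≪ Λ) (hν : π.map Prod.snd ≪ Λ') (hπ : π ≪ Λ.prod Λ') :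
    π ≪ (π.map Prod.fst).prod (π.map Prod.snd) := by
  have hf : ∀ᵐ p ∂π, 0 < (π.map Prod.fst).rnDeriv Λ p.1 :=
    ae_of_ae_map measurable_fst.aemeasurable (Measure.rnDeriv_pos hμ)
  have hg : ∀ᵐ p ∂π, 0 < (π.map Prod.snd).rnDeriv Λ' p.2 :=
    ae_of_ae_map measurable_snd.aemeasurable (Measure.rnDeriv_pos hν)
  have hprod := prod_withDensity (μ := Λ) (ν := Λ')
    (Measure.measurable_rnDeriv (π.map Prod.fst) Λ) (Measure.measurable_rnDeriv (π.map Prod.snd) Λ')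
  rw [Measure.withDensity_rnDeriv_eq _ _ hμ, Measure.withDensity_rnDeriv_eq _ _ hν] at hprod
  intro s hs
  rw [measure_eq_zero_iff_ae_notMem] at hs ⊢
  rw [hprod, ae_withDensity_iff (by fun_prop)] at hs
  filter_upwards [hπ.ae_le hs, hf, hg] with p hp h1 h2
  have hne := mul_ne_zero h1.ne' h2.ne'
  exact hp hne

/-- The log-likelihood ratio of product measures splits along the coordinates, almost
everywhere for any dominated measure whose marginals are the two factors. -/
lemma llr_prod_ae_eq_add {π : Measure (Z × Y)} {μ Λ : Measure Z} {ν Λ' : Measure Y}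
    [SigmaFinite μ] [SigmaFinite ν] [SigmaFinite Λ] [SigmaFinite Λ'] (hμ : μ ≪ Λ) (hν : ν ≪ Λ')
    (hπ1 : π.map Prod.fst = μ) (hπ2 : π.map Prod.snd = ν) (hπ : π ≪ Λ.prod Λ') :
    llr (μ.prod ν) (Λ.prod Λ') =ᵐ[π] fun p ↦ llr μ Λ p.1 + llr ν Λ' p.2 := by
  have hf : ∀ᵐ x ∂μ, 0 < μ.rnDeriv Λ x ∧ μ.rnDeriv Λ x < ⊤ :=
    (Measure.rnDeriv_pos hμ).and (hμ.ae_le (Measure.rnDeriv_lt_top μ Λ))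
  have hg : ∀ᵐ y ∂ν, 0 < ν.rnDeriv Λ' y ∧ ν.rnDeriv Λ' y < ⊤ :=
    (Measure.rnDeriv_pos hν).and (hν.ae_le (Measure.rnDeriv_lt_top ν Λ'))
  rw [← hπ1] at hf
  rw [← hπ2] at hg
  filter_upwards [hπ.ae_le (Measure.rnDeriv_prod_prod hμ hν),
    ae_of_ae_map measurable_fst.aemeasurable hf,
    ae_of_ae_map measurable_snd.aemeasurable hg] with p hp h1 h2
  rw [hπ1] at h1
  rw [hπ2] at h2
  simp only [llr, hp, ENNReal.toReal_mul]
  exact Real.log_mul (ENNReal.toReal_pos h1.1.ne' h1.2.ne).ne'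
    (ENNReal.toReal_pos h2.1.ne' h2.2.ne).ne'

lemma Integrable.of_add_prod {μ : Measure Z} {ν : Measure Y} [IsProbabilityMeasure μ]
    [IsProbabilityMeasure ν] {a : Z → ℝ} {b : Y → ℝ}
    (h : Integrable (fun p : Z × Y ↦ a p.1 + b p.2) (μ.prod ν)) :
    Integrable a μ ∧ Integrable b ν := by
  obtain ⟨y, hy⟩ := h.prod_left_ae.exists
  obtain ⟨x, hx⟩ := h.prod_right_ae.exists
  exact ⟨(integrable_add_const_iff (c := b y)).mp hy, (integrable_const_add_iff (c := a x)).mp hx⟩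

/-- The log-likelihood ratio of a product of probability measures has the same integral
under every dominated coupling of the two factors. -/
lemma integrable_llr_prod_and_integral_eq {π : Measure (Z × Y)} {μ Λ : Measure Z}
    {ν Λ' : Measure Y} [IsProbabilityMeasure μ] [IsProbabilityMeasure ν] [SigmaFinite Λ]
    [SigmaFinite Λ'] (hμ : μ ≪ Λ) (hν : ν ≪ Λ')
    (h_int : Integrable (llr (μ.prod ν) (Λ.prod Λ')) (μ.prod ν))
    (hπ1 : π.map Prod.fst = μ) (hπ2 : π.map Prod.snd = ν) (hπ : π ≪ Λ.prod Λ') :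
    Integrable (llr (μ.prod ν) (Λ.prod Λ')) π ∧
      ∫ p, llr (μ.prod ν) (Λ.prod Λ') p ∂π = ∫ x, llr μ Λ x ∂μ + ∫ y, llr ν Λ' y ∂ν := by
  have hsplit := llr_prod_ae_eq_add hμ hν (π := μ.prod ν) (by simp) (by simp) (hμ.prod hν)
  obtain ⟨ha, hb⟩ := Integrable.of_add_prod (h_int.congr hsplit)
  have hae := llr_prod_ae_eq_add hμ hν hπ1 hπ2 hπ
  have m1 : MeasurePreserving Prod.fst π μ := ⟨measurable_fst, hπ1⟩
  have m2 : MeasurePreserving Prod.snd π ν := ⟨measurable_snd, hπ2⟩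
  have ha' : Integrable (fun p : Z × Y ↦ llr μ Λ p.1) π := m1.integrable_comp_of_integrable ha
  have hb' : Integrable (fun p : Z × Y ↦ llr ν Λ' p.2) π := m2.integrable_comp_of_integrable hb
  refine ⟨(ha'.add hb').congr hae.symm, ?_⟩
  rw [integral_congr_ae hae, integral_add ha' hb']
  congr 1
  · rw [← hπ1, integral_map measurable_fst.aemeasurable]
    rw [hπ1]
    exact ha.aestronglyMeasurable
  · rw [← hπ2, integral_map measurable_snd.aemeasurable]
    rw [hπ2]
    exact hb.aestronglyMeasurable

end MeasureTheory

theorem stmt_15 {d : ℕ} (X : Set (EuclideanSpace ℝ (Fin d))) (hX : IsCompact X)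
    (Λ : Measure (EuclideanSpace ℝ (Fin d))) (hΛ : Λ = volume.restrict X)
    (μ ν : Measure (EuclideanSpace ℝ (Fin d)))
    [IsProbabilityMeasure μ] [IsProbabilityMeasure ν]
    (hμ : μ ≪ Λ) (hν : ν ≪ Λ)
    (hKLμν : Integrable
      (fun p => Real.log (((μ.prod ν).rnDeriv (Λ.prod Λ) p).toReal)) (μ.prod ν))
    (π : Measure (EuclideanSpace ℝ (Fin d) × EuclideanSpace ℝ (Fin d)))
    [IsProbabilityMeasure π]
    (hπ1 : π.map Prod.fst = μ) (hπ2 : π.map Prod.snd = ν)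
    (hπac : π ≪ Λ.prod Λ)
    (hKLπ : Integrable (fun p => Real.log ((π.rnDeriv (Λ.prod Λ) p).toReal)) π) :
    KLr π (Λ.prod Λ) - KLr (μ.prod ν) (Λ.prod Λ) = KLr π (μ.prod ν) := by
  have : SigmaFinite Λ := by rw [hΛ]; infer_instance
  have hac : π ≪ μ.prod ν := by
    have h := Measure.absolutelyContinuous_prod_map_fst_map_snd (hπ1.symm ▸ hμ) (hπ2.symm ▸ hν) hπac
    rwa [hπ1, hπ2] at h
  obtain ⟨hint, heq⟩ := integrable_llr_prod_and_integral_eq hμ hν hKLμν hπ1 hπ2 hπac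
  obtain ⟨-, heq'⟩ := integrable_llr_prod_and_integral_eq hμ hν hKLμν (π := μ.prod ν)
    (by simp) (by simp) (hμ.prod hν)
  have hchain := llr_ae_eq_llr_add_llr hac (hμ.prod hν)
  have hkey : ∫ p, llr π (μ.prod ν) p ∂π =
      ∫ p, llr π (Λ.prod Λ) p ∂π - ∫ p, llr (μ.prod ν) (Λ.prod Λ) p ∂μ.prod ν := by
    rw [heq', ← heq, ← integral_sub (f := llr π (Λ.prod Λ)) hKLπ hint]
    refine integral_congr_ae ?_
    filter_upwards [hchain] with p hp
    rw [hp, add_sub_cancel_right]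
  simp only [llr] at hkey
  simp only [KLr, hkey, measure_univ]
  ring
end

section
/- Let 𝕏, 𝕐 ⊂ ℝ^d be compact, μ ∈ P(𝕏), ν ∈ P(𝕐), c : 𝕏 × 𝕐 → [0, ∞) continuous, and ε > 0. Suppose φ : 𝕏 → ℝ and ψ : 𝕐 → ℝ are bounded measurable functions such that the measure π* := exp((φ(x) + ψ(y) − c(x, y))/ε) · (μ ⊗ ν) belongs to Π(μ, ν). Then π* is the unique minimizer of the regularized optimal transport functional: for every π ∈ Π(μ, ν), ∫ c dπ + ε KL(π, μ ⊗ ν) ≥ ∫ c dπ* + ε KL(π*, μ ⊗ ν), with equality only for π = π*. -/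
open MeasureTheory Classical

/-- The Kullback--Leibler divergence of probability measures,
`KL(α, β) = ∫ log (dα/dβ) dα`, with value `∞` when `α` is not absolutely continuous
with respect to `β` or the integrand is not integrable. -/
noncomputable def KLe {Z : Type*} [MeasurableSpace Z] (α β : Measure Z) : ENNReal :=
  if α ≪ β ∧ Integrable (fun z => Real.log ((α.rnDeriv β z).toReal)) α then
    ENNReal.ofReal (∫ z, Real.log ((α.rnDeriv β z).toReal) ∂α)
  else ⊤

open InformationTheory

/-- Between probability measures, `KLe` is Mathlib's Kullback--Leibler divergence. -/
theorem KLe_eq_klDiv {Z : Type*} [MeasurableSpace Z] (α β : Measure Z)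
    [IsProbabilityMeasure α] [IsProbabilityMeasure β] : KLe α β = klDiv α β := by
  rw [klDiv_def, KLe]
  simp [llr_def]

/-- Tilting the reference measure by a normalized density `exp f` keeps the divergence finite. -/
theorem klDiv_tilted_ne_top {Z : Type*} [MeasurableSpace Z] {α β : Measure Z} {f : Z → ℝ}
    [IsProbabilityMeasure α] [IsProbabilityMeasure β] (hfα : Integrable f α)
    (hfβ : Integrable (fun z => Real.exp (f z)) β) (h : klDiv α β ≠ ⊤) :
    klDiv α (β.tilted f) ≠ ⊤ := by
  obtain ⟨hac, hint⟩ := klDiv_ne_top_iff.1 h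
  exact klDiv_ne_top (hac.trans (absolutelyContinuous_tilted hfβ))
    (integrable_llr_tilted_right hac hfα hint hfβ)

/-- Change of reference measure: tilting by a normalized density `exp f` shifts the divergence by
`∫ f dα`. -/
theorem toReal_klDiv_eq_integral_add_klDiv_tilted {Z : Type*} [MeasurableSpace Z]
    {α β : Measure Z} {f : Z → ℝ} [IsProbabilityMeasure α] [IsProbabilityMeasure β]
    (hfα : Integrable f α) (hfβ : Integrable (fun z => Real.exp (f z)) β)
    (h1 : ∫ z, Real.exp (f z) ∂β = 1) (h : klDiv α β ≠ ⊤) :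
    (klDiv α β).toReal = ∫ z, f z ∂α + (klDiv α (β.tilted f)).toReal := by
  obtain ⟨hac, hint⟩ := klDiv_ne_top_iff.1 h
  have := isProbabilityMeasure_tilted hfβ
  rw [toReal_klDiv_of_measure_eq hac (by simp),
    toReal_klDiv_of_measure_eq (hac.trans (absolutelyContinuous_tilted hfβ)) (by simp),
    integral_llr_tilted_right hac hfα hfβ hint, h1, Real.log_one]
  ring

theorem klDiv_tilted_left_ne_top {Z : Type*} [MeasurableSpace Z] {β : Measure Z} {f : Z → ℝ}
    [IsProbabilityMeasure β] (hfβ : Integrable (fun z => Real.exp (f z)) β)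
    (hf : Integrable f (β.tilted f)) : klDiv (β.tilted f) β ≠ ⊤ := by
  have := isProbabilityMeasure_tilted hfβ
  have hac := tilted_absolutelyContinuous β f
  refine klDiv_ne_top hac ?_
  rw [llr_def, integrable_congr (hac.ae_le (log_rnDeriv_tilted_left_self hfβ))]
  exact hf.sub (integrable_const _)

theorem stmt_16 {d : ℕ} (X Y : Set (EuclideanSpace ℝ (Fin d)))
    (hX : IsCompact X) (hY : IsCompact Y)
    (μ : Measure X) (ν : Measure Y) [IsProbabilityMeasure μ] [IsProbabilityMeasure ν]
    (c : X × Y → ℝ) (hc : Continuous c) (hc0 : ∀ p, 0 ≤ c p)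
    (ε : ℝ) (hε : 0 < ε)
    (φ : X → ℝ) (ψ : Y → ℝ) (hφm : Measurable φ) (hψm : Measurable ψ)
    (hφb : ∃ C, ∀ x, |φ x| ≤ C) (hψb : ∃ C, ∀ y, |ψ y| ≤ C)
    (πs : Measure (X × Y))
    (hπs : πs = (μ.prod ν).withDensity
      fun p => ENNReal.ofReal (Real.exp ((φ p.1 + ψ p.2 - c p) / ε)))
    (hπs1 : πs.map Prod.fst = μ) (hπs2 : πs.map Prod.snd = ν) :
    ∀ π : Measure (X × Y), IsProbabilityMeasure π →
      π.map Prod.fst = μ → π.map Prod.snd = ν →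
      (ENNReal.ofReal (∫ p, c p ∂πs) + ENNReal.ofReal ε * KLe πs (μ.prod ν)
        ≤ ENNReal.ofReal (∫ p, c p ∂π) + ENNReal.ofReal ε * KLe π (μ.prod ν)) ∧
      (ENNReal.ofReal (∫ p, c p ∂π) + ENNReal.ofReal ε * KLe π (μ.prod ν)
          = ENNReal.ofReal (∫ p, c p ∂πs) + ENNReal.ofReal ε * KLe πs (μ.prod ν) →
        π = πs) := by
  have : CompactSpace X := isCompact_iff_compactSpace.1 hX
  have : CompactSpace Y := isCompact_iff_compactSpace.1 hY
  obtain ⟨A, hA⟩ := hφb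
  obtain ⟨B, hB⟩ := hψb
  obtain ⟨C, hC⟩ : ∃ C, ∀ p, |c p| ≤ C := by
    obtain ⟨C, hC⟩ := isCompact_univ.exists_bound_of_continuousOn hc.continuousOn
    exact ⟨C, fun p => hC p (Set.mem_univ p)⟩
  set f : X × Y → ℝ := fun p => (φ p.1 + ψ p.2 - c p) / ε with hf
  have hcm : Measurable c := hc.measurable
  have hfm : Measurable f := by fun_prop
  have hfb : ∀ p, |f p| ≤ (A + B + C) / ε := by
    intro p
    rw [hf, abs_div, abs_of_pos hε]
    gcongr
    have := abs_le.1 (hA p.1)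
    have := abs_le.1 (hB p.2)
    have := abs_le.1 (hC p)
    exact abs_le.2 ⟨by linarith, by linarith⟩
  have bdd_int : ∀ (α : Measure (X × Y)) [IsProbabilityMeasure α] (g : X × Y → ℝ) (K : ℝ),
      Measurable g → (∀ p, |g p| ≤ K) → Integrable g α := fun α _ g K hg hK =>
    Integrable.of_bound hg.aestronglyMeasurable K (ae_of_all _ hK)
  have hexp : Integrable (fun p => Real.exp (f p)) (μ.prod ν) := by
    refine bdd_int _ _ (Real.exp ((A + B + C) / ε)) hfm.exp fun p => ?_
    rw [Real.abs_exp]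
    exact Real.exp_le_exp.2 ((le_abs_self _).trans (hfb p))
  have hπs_prob : IsProbabilityMeasure πs := by
    have : IsProbabilityMeasure (πs.map Prod.fst) := by rw [hπs1]; infer_instance
    exact Measure.isProbabilityMeasure_of_map Prod.fst
  have hexp1 : ∫ p, Real.exp (f p) ∂(μ.prod ν) = 1 := by
    rw [integral_eq_lintegral_of_nonneg_ae (ae_of_all _ fun p => (Real.exp_pos _).le)
      hexp.aestronglyMeasurable, ← setLIntegral_univ, ← withDensity_apply _ MeasurableSet.univ,
      ← hπs, measure_univ, ENNReal.toReal_one]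
  have htilt : πs = (μ.prod ν).tilted f := by
    rw [Measure.tilted, hexp1, hπs]
    simp [hf]
  have hcost : ∀ π : Measure (X × Y), IsProbabilityMeasure π → π.map Prod.fst = μ →
      π.map Prod.snd = ν → klDiv π (μ.prod ν) ≠ ⊤ →
      ENNReal.ofReal (∫ p, c p ∂π) + ENNReal.ofReal ε * klDiv π (μ.prod ν) =
        ENNReal.ofReal (∫ x, φ x ∂μ + ∫ y, ψ y ∂ν + ε * (klDiv π πs).toReal) ∧
      0 ≤ ∫ x, φ x ∂μ + ∫ y, ψ y ∂ν + ε * (klDiv π πs).toReal := by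
    intro π _ h1 h2 hfin
    have hreal : ∫ p, c p ∂π + ε * (klDiv π (μ.prod ν)).toReal =
        ∫ x, φ x ∂μ + ∫ y, ψ y ∂ν + ε * (klDiv π πs).toReal := by
      have e1 : ∫ x, φ x ∂μ = ∫ p, φ p.1 ∂π := by
        rw [← h1, integral_map measurable_fst.aemeasurable hφm.aestronglyMeasurable]
      have e2 : ∫ y, ψ y ∂ν = ∫ p, ψ p.2 ∂π := by
        rw [← h2, integral_map measurable_snd.aemeasurable hψm.aestronglyMeasurable]
      have i1 : Integrable (fun p : X × Y => φ p.1) π :=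
        bdd_int π _ A (by fun_prop) fun p => hA p.1
      have i2 : Integrable (fun p : X × Y => ψ p.2) π :=
        bdd_int π _ B (by fun_prop) fun p => hB p.2
      have i3 : Integrable c π := bdd_int π c C hcm hC
      have e3 : ∫ p, f p ∂π = (∫ p, φ p.1 ∂π + ∫ p, ψ p.2 ∂π - ∫ p, c p ∂π) / ε := by
        rw [hf, integral_div, integral_sub (by exact i1.add i2) i3, integral_add i1 i2]
      rw [toReal_klDiv_eq_integral_add_klDiv_tilted (bdd_int π f _ hfm hfb) hexp hexp1 hfin,
        ← htilt, e1, e2, e3]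
      field_simp
      ring
    have hc_nonneg : 0 ≤ ∫ p, c p ∂π := integral_nonneg hc0
    rw [← hreal, ENNReal.ofReal_add hc_nonneg (by positivity), ENNReal.ofReal_mul hε.le,
      ENNReal.ofReal_toReal hfin]
    exact ⟨rfl, by positivity⟩
  have hπs_fin : klDiv πs (μ.prod ν) ≠ ⊤ := by
    have hi := bdd_int πs f _ hfm hfb
    rw [htilt] at hi ⊢
    exact klDiv_tilted_left_ne_top hexp hi
  obtain ⟨hs, hs0⟩ := hcost πs hπs_prob hπs1 hπs2 hπs_fin
  intro π hπ h1 h2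
  rw [KLe_eq_klDiv, KLe_eq_klDiv, hs]
  rw [klDiv_self, ENNReal.toReal_zero, mul_zero, add_zero] at hs0 ⊢
  by_cases hfin : klDiv π (μ.prod ν) = ⊤
  · simp [hfin, ENNReal.mul_top, hε]
  obtain ⟨hp, hp0⟩ := hcost π hπ h1 h2 hfin
  rw [hp]
  refine ⟨ENNReal.ofReal_le_ofReal (le_add_of_nonneg_right (by positivity)), fun h => ?_⟩
  rw [ENNReal.ofReal_eq_ofReal_iff hp0 hs0] at h
  have hzero : (klDiv π πs).toReal = 0 := by
    simpa [hε.ne'] using h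
  have hne : klDiv π πs ≠ ⊤ := by
    rw [htilt]
    exact klDiv_tilted_ne_top (bdd_int π f _ hfm hfb) hexp hfin
  exact klDiv_eq_zero_iff.1 (((ENNReal.toReal_eq_zero_iff _).1 hzero).resolve_right hne)
end
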